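/- Let $c = 1/(4\zeta(3))$ and let $(S_n)_{n \ge 0}$ be the locally perturbed random walk with unbounded jumps on $\mathbb{Z}^2$: a Markov chain with $S_0 = (0,0)$ such that from the origin, $P(S_{n+1} = S_n \pm e_i \mid S_n = (0,0)) = 1/4$ for $i = 1,2$, while from every state $x \neq (0,0)$, $P(S_{n+1} = S_n \pm m\, e_i \mid S_n = x) = c/m^3$ for every integer $m \ge 1$ and $i = 1,2$. Then there exists a constant $C > 0$ such that $S_n / \sqrt{n \log n}$ converges in distribution as $n \to \infty$ to the centered planar Gaussian law with covariance matrix $C^2 I_2$. -/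

import Mathlib

open MeasureTheory ProbabilityTheory Filter
open scoped NNReal ENNReal Topology

/-- Apéry's constant `ζ(3) = ∑_{m ≥ 1} 1/m³`. -/
noncomputable def zeta3 : ℝ := ∑' m : ℕ, 1 / ((m : ℝ) + 1) ^ 3

/-- The normalizing constant `c = 1/(4 ζ(3))` of the step distribution. -/
noncomputable def cZeta : ℝ := 1 / (4 * zeta3)

/-- The four signed standard unit vectors of `ℤ²`. -/
def nbrs : Finset (ℤ × ℤ) := {(1, 0), (-1, 0), (0, 1), (0, -1)}

/-- The cylinder event that the trajectory `S` follows the history `h` up to time `n`. -/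
def prefixEvent {Ω : Type*} (S : ℕ → Ω → ℤ × ℤ) (n : ℕ) (h : ℕ → ℤ × ℤ) : Set Ω :=
  {ω | ∀ k ≤ n, S k ω = h k}

/-- Embedding of `ℤ²` into `ℝ²`. -/
def embed (x : ℤ × ℤ) : ℝ × ℝ := ((x.1 : ℝ), (x.2 : ℝ))

/-- The centered planar Gaussian measure with covariance matrix `diag (v, v)`. -/
noncomputable def gauss2 (v : ℝ≥0) : Measure (ℝ × ℝ) :=
  (gaussianReal 0 v).prod (gaussianReal 0 v)

/-- The cosine series `∑_{m ≥ 1} (1 - cos (m θ)) / m³`. -/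
noncomputable def cosDefect (θ : ℝ) : ℝ :=
  ∑' m : ℕ, (1 - Real.cos ((m + 1) * θ)) / ((m : ℝ) + 1) ^ 3

lemma summable_inv_succ_cube : Summable fun m : ℕ => 1 / ((m : ℝ) + 1) ^ 3 := by
  have h := (summable_nat_add_iff 1).2
    (Real.summable_one_div_nat_pow.2 (by norm_num : 1 < 3))
  simpa using h

lemma summable_cosDefect (θ : ℝ) :
    Summable fun m : ℕ => (1 - Real.cos ((m + 1) * θ)) / ((m : ℝ) + 1) ^ 3 := by
  refine Summable.of_nonneg_of_le (fun m => ?_) (fun m => ?_)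
    (summable_inv_succ_cube.mul_left 2)
  · have := Real.cos_le_one ((m + 1) * θ)
    exact div_nonneg (by linarith) (by positivity)
  · have := Real.neg_one_le_cos ((m + 1) * θ)
    rw [mul_one_div]
    gcongr
    linarith

lemma zeta3_pos : 0 < zeta3 :=
  summable_inv_succ_cube.tsum_pos (fun m => by positivity) 0 (by norm_num)

lemma cZeta_pos : 0 < cZeta := by
  have := zeta3_pos
  unfold cZeta
  positivity

lemma cZeta_mul_zeta3 : cZeta * zeta3 = 1 / 4 := by
  have := zeta3_pos
  unfold cZeta
  field_simp

@[simp] lemma cosDefect_zero : cosDefect 0 = 0 := by simp [cosDefect]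

lemma cosDefect_abs (θ : ℝ) : cosDefect |θ| = cosDefect θ := by
  rcases abs_cases θ with ⟨h, -⟩ | ⟨h, -⟩ <;> simp [h, cosDefect]

lemma one_sub_cos_le_cosDefect (θ : ℝ) : 1 - Real.cos θ ≤ cosDefect θ := by
  have h := (summable_cosDefect θ).le_tsum 0 fun m _ => by
    have := Real.cos_le_one ((m + 1) * θ)
    exact div_nonneg (by linarith) (by positivity)
  simpa [cosDefect] using h

lemma cosDefect_nonneg (θ : ℝ) : 0 ≤ cosDefect θ :=
  (sub_nonneg.2 (Real.cos_le_one θ)).trans (one_sub_cos_le_cosDefect θ)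

lemma cosDefect_le (θ : ℝ) : cosDefect θ ≤ 2 * zeta3 := by
  unfold cosDefect zeta3
  rw [← tsum_mul_left]
  refine (summable_cosDefect θ).tsum_le_tsum (fun m => ?_) (summable_inv_succ_cube.mul_left 2)
  have := Real.neg_one_le_cos ((m + 1) * θ)
  rw [mul_one_div]
  gcongr
  linarith

lemma sum_Ico_inv_succ_cube_le {M N : ℕ} :
    ∑ m ∈ Finset.Ico M N, 1 / ((m : ℝ) + 1) ^ 3 ≤ 2 / ((M : ℝ) + 1) ^ 2 := by
  have h := sum_Ioo_inv_sq_le (α := ℝ) M (N + 1)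
  have hI : Finset.Ioo M (N + 1) = Finset.Ico (M + 1) (N + 1) := by
    ext; simp
  rw [hI, ← Finset.sum_Ico_add' (fun i : ℕ => ((i : ℝ) ^ 2)⁻¹) M N 1] at h
  calc ∑ m ∈ Finset.Ico M N, 1 / ((m : ℝ) + 1) ^ 3
      ≤ ∑ m ∈ Finset.Ico M N, 1 / ((M : ℝ) + 1) * (((m + 1 : ℕ) : ℝ) ^ 2)⁻¹ := by
        refine Finset.sum_le_sum fun m hm => ?_
        have hm' : (M : ℝ) ≤ m := by exact_mod_cast (Finset.mem_Ico.1 hm).1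
        rw [← one_div, one_div_mul_one_div, pow_succ']
        push_cast
        gcongr
    _ = 1 / ((M : ℝ) + 1) * ∑ m ∈ Finset.Ico M N, (((m + 1 : ℕ) : ℝ) ^ 2)⁻¹ := by
        rw [Finset.mul_sum]
    _ ≤ 1 / ((M : ℝ) + 1) * (2 / (M + 1)) := by gcongr
    _ = 2 / ((M : ℝ) + 1) ^ 2 := by rw [div_mul_div_comm]; ring

/-- `cosDefect θ = (θ² / 2) log (1 / θ) + O(θ²)`. -/
lemma abs_cosDefect_sub_le {θ : ℝ} (h0 : 0 < θ) (h1 : θ ≤ 1) :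
    |cosDefect θ - θ ^ 2 / 2 * Real.log θ⁻¹| ≤ 6 * θ ^ 2 := by
  set M := ⌊θ⁻¹⌋₊ with hM
  have hMle : (M : ℝ) ≤ θ⁻¹ := Nat.floor_le (by positivity)
  have hMθ : (M : ℝ) * θ ≤ 1 := by
    calc (M : ℝ) * θ ≤ θ⁻¹ * θ := by gcongr
      _ = 1 := inv_mul_cancel₀ h0.ne'
  have hMlt : 1 ≤ ((M : ℝ) + 1) * θ := by
    calc (1 : ℝ) = θ⁻¹ * θ := (inv_mul_cancel₀ h0.ne').symm
      _ ≤ _ := by gcongr; exact (Nat.lt_floor_add_one _).le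
  have hharm : |((harmonic M : ℚ) : ℝ) - Real.log θ⁻¹| ≤ 1 := by
    have h2 := log_le_harmonic_floor θ⁻¹ (by positivity)
    have h3 := harmonic_floor_le_one_add_log θ⁻¹ ((one_le_inv₀ h0).2 h1)
    rw [abs_le]; constructor <;> linarith
  have hhead : |∑ m ∈ Finset.range M, (1 - Real.cos ((m + 1) * θ)) / ((m : ℝ) + 1) ^ 3
      - θ ^ 2 / 2 * ((harmonic M : ℚ) : ℝ)| ≤ θ ^ 2 := by
    have : ((harmonic M : ℚ) : ℝ) = ∑ m ∈ Finset.range M, ((m : ℝ) + 1)⁻¹ := by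
      simp [harmonic]
    rw [this, Finset.mul_sum, ← Finset.sum_sub_distrib]
    calc _ ≤ ∑ m ∈ Finset.range M, |(1 - Real.cos ((m + 1) * θ)) / ((m : ℝ) + 1) ^ 3
            - θ ^ 2 / 2 * ((m : ℝ) + 1)⁻¹| := Finset.abs_sum_le_sum_abs _ _
      _ ≤ ∑ m ∈ Finset.range M, θ ^ 3 := by
          refine Finset.sum_le_sum fun m hm => ?_
          have hm' : (m : ℝ) + 1 ≤ M := by exact_mod_cast Finset.mem_range.1 hm
          have hu : ((m : ℝ) + 1) * θ ≤ 1 := le_trans (by gcongr) hMθ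
          have hu0 : 0 ≤ ((m : ℝ) + 1) * θ := by positivity
          have hb := Real.cos_bound (x := ((m : ℝ) + 1) * θ) (by rwa [abs_of_nonneg hu0])
          rw [abs_of_nonneg hu0] at hb
          have e : (1 - Real.cos ((m + 1) * θ)) / ((m : ℝ) + 1) ^ 3 - θ ^ 2 / 2 * ((m : ℝ) + 1)⁻¹
              = -(Real.cos ((m + 1) * θ) - (1 - (((m : ℝ) + 1) * θ) ^ 2 / 2))
                / ((m : ℝ) + 1) ^ 3 := by
            field_simp; ring
          have hp : (0 : ℝ) < ((m : ℝ) + 1) ^ 3 := by positivity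
          rw [e, abs_div, abs_neg, abs_of_pos hp, div_le_iff₀ hp]
          refine hb.trans ?_
          have e2 : θ ^ 3 * ((m : ℝ) + 1) ^ 3 = (((m : ℝ) + 1) * θ) ^ 3 := by ring
          rw [e2]
          nlinarith [pow_nonneg hu0 3]
      _ = (M * θ) * θ ^ 2 := by simp; ring
      _ ≤ 1 * θ ^ 2 := by gcongr
      _ = θ ^ 2 := one_mul _
  have hpart : ∀ N, M ≤ N →
      |∑ m ∈ Finset.range N, (1 - Real.cos ((m + 1) * θ)) / ((m : ℝ) + 1) ^ 3
      - θ ^ 2 / 2 * Real.log θ⁻¹| ≤ 6 * θ ^ 2 := by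
    intro N hN
    rw [← Finset.sum_range_add_sum_Ico _ hN]
    have htail : |∑ m ∈ Finset.Ico M N, (1 - Real.cos ((m + 1) * θ)) / ((m : ℝ) + 1) ^ 3|
        ≤ 4 * θ ^ 2 := by
      calc _ ≤ ∑ m ∈ Finset.Ico M N, |(1 - Real.cos ((m + 1) * θ)) / ((m : ℝ) + 1) ^ 3| :=
            Finset.abs_sum_le_sum_abs _ _
        _ ≤ ∑ m ∈ Finset.Ico M N, 2 * (1 / ((m : ℝ) + 1) ^ 3) := by
            refine Finset.sum_le_sum fun m _ => ?_
            have hp : (0 : ℝ) < ((m : ℝ) + 1) ^ 3 := by positivity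
            rw [abs_div, abs_of_pos hp, mul_one_div]
            gcongr
            rw [abs_le]
            constructor <;> linarith [Real.neg_one_le_cos ((m + 1) * θ),
              Real.cos_le_one ((m + 1) * θ)]
        _ ≤ 2 * (2 / ((M : ℝ) + 1) ^ 2) := by
            rw [← Finset.mul_sum]; gcongr; exact sum_Ico_inv_succ_cube_le
        _ ≤ 4 * θ ^ 2 := by
            rw [mul_div_assoc', div_le_iff₀ (by positivity)]
            nlinarith
    have hl : |θ ^ 2 / 2 * ((harmonic M : ℚ) : ℝ) - θ ^ 2 / 2 * Real.log θ⁻¹| ≤ θ ^ 2 := by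
      rw [← mul_sub, abs_mul, abs_of_nonneg (by positivity)]
      nlinarith [sq_nonneg θ]
    rw [abs_le] at *
    constructor <;> linarith [hhead.1, hhead.2, htail.1, htail.2, hl.1, hl.2]
  have ht := (((summable_cosDefect θ).hasSum.tendsto_sum_nat).sub_const
    (θ ^ 2 / 2 * Real.log θ⁻¹)).abs
  exact le_of_tendsto ht (eventually_atTop.2 ⟨M, hpart⟩)

lemma tendsto_nat_mul_log : Tendsto (fun n : ℕ => (n : ℝ) * Real.log n) atTop atTop :=
  tendsto_natCast_atTop_atTop.atTop_mul_atTop₀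
    (Real.tendsto_log_atTop.comp tendsto_natCast_atTop_atTop)

lemma tendsto_mul_cosDefect (s : ℝ) :
    Tendsto (fun n : ℕ => (n : ℝ) * cosDefect ((Real.sqrt (n * Real.log n))⁻¹ * s)) atTop
      (𝓝 (s ^ 2 / 4)) := by
  wlog hs : 0 < s generalizing s
  · rcases eq_or_ne s 0 with rfl | h
    · simp
    · have := this |s| (abs_pos.2 h)
      rw [sq_abs] at this
      refine this.congr fun n => ?_
      rw [← cosDefect_abs (_ * s), abs_mul, abs_of_nonneg (a := (Real.sqrt _)⁻¹) (by positivity)]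
  have hlog : Tendsto (fun n : ℕ => Real.log n) atTop atTop :=
    Real.tendsto_log_atTop.comp tendsto_natCast_atTop_atTop
  have hloginv : Tendsto (fun n : ℕ => (Real.log n)⁻¹) atTop (𝓝 0) := hlog.inv_tendsto_atTop
  have hll : Tendsto (fun n : ℕ => Real.log (Real.log n) / Real.log n) atTop (𝓝 0) :=
    (Real.isLittleO_log_id_atTop.tendsto_div_nhds_zero).comp hlog
  have hθ : Tendsto (fun n : ℕ => (Real.sqrt (n * Real.log n))⁻¹ * s) atTop (𝓝 0) := by
    have := (Real.tendsto_sqrt_atTop.comp tendsto_nat_mul_log).inv_tendsto_atTop.mul_const s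
    simpa using this
  have hmain : Tendsto (fun n : ℕ => s ^ 2 / 4 *
      (1 + Real.log (Real.log n) / Real.log n - 2 * Real.log s * (Real.log n)⁻¹)) atTop
      (𝓝 (s ^ 2 / 4)) := by
    have := ((hll.const_add 1).sub (hloginv.const_mul (2 * Real.log s))).const_mul (s ^ 2 / 4)
    simpa using this
  have herr : Tendsto (fun n : ℕ => 6 * s ^ 2 * (Real.log n)⁻¹) atTop (𝓝 0) := by
    simpa using hloginv.const_mul (6 * s ^ 2)
  have hdiff : Tendsto (fun n : ℕ => (n : ℝ) * cosDefect ((Real.sqrt (n * Real.log n))⁻¹ * s)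
      - s ^ 2 / 4 * (1 + Real.log (Real.log n) / Real.log n
        - 2 * Real.log s * (Real.log n)⁻¹)) atTop (𝓝 0) := by
    refine squeeze_zero_norm' ?_ herr
    filter_upwards [hθ.eventually_le_const zero_lt_one, eventually_gt_atTop 0,
      hlog.eventually_gt_atTop 0] with n hn1 hn0 hL
    have hn : (0 : ℝ) < n := by exact_mod_cast hn0
    set L := Real.log n with hLdef
    have hsq : 0 < Real.sqrt (n * L) := Real.sqrt_pos.2 (by positivity)
    set θ := (Real.sqrt (n * L))⁻¹ * s with hθdef
    have hθ0 : 0 < θ := by positivity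
    have hθ2 : (n : ℝ) * θ ^ 2 = s ^ 2 * L⁻¹ := by
      rw [hθdef, mul_pow, inv_pow, Real.sq_sqrt (by positivity)]
      field_simp
    have hlogθ : Real.log θ⁻¹ = (L + Real.log L) / 2 - Real.log s := by
      rw [hθdef, Real.log_inv, Real.log_mul (by positivity) hs.ne', Real.log_inv,
        Real.log_sqrt (by positivity), Real.log_mul hn.ne' hL.ne']
      ring
    have hb := abs_cosDefect_sub_le hθ0 hn1
    have e : (n : ℝ) * cosDefect θ - s ^ 2 / 4 * (1 + Real.log L / L - 2 * Real.log s * L⁻¹)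
        = n * (cosDefect θ - θ ^ 2 / 2 * Real.log θ⁻¹) := by
      have : (n : ℝ) * (θ ^ 2 / 2 * Real.log θ⁻¹) = (n * θ ^ 2) / 2 * Real.log θ⁻¹ := by ring
      rw [mul_sub (n : ℝ), this, hθ2, hlogθ]
      field_simp
      ring
    rw [e, Real.norm_eq_abs, abs_mul, abs_of_pos hn]
    calc (n : ℝ) * _ ≤ n * (6 * θ ^ 2) := by gcongr
      _ = 6 * (n * θ ^ 2) := by ring
      _ = 6 * s ^ 2 * L⁻¹ := by rw [hθ2]; ring
  simpa using hdiff.add hmain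

lemma hasSum_of_eq {ι E : Type*} [AddCommMonoid E] [TopologicalSpace E] {f g : ι → E} {a : E}
    (h : HasSum g a) (e : ∀ i, f i = g i) :
    HasSum f a := by
  rwa [funext e]

/-- The character `x ↦ exp (i t·x)` of `ℤ²`. -/
noncomputable def latticeChar (t : ℝ × ℝ) (x : ℤ × ℤ) : ℂ :=
  Complex.exp (((t.1 * x.1 + t.2 * x.2 : ℝ) : ℂ) * Complex.I)

lemma latticeChar_add (t : ℝ × ℝ) (x y : ℤ × ℤ) :
    latticeChar t (x + y) = latticeChar t x * latticeChar t y := by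
  rw [latticeChar, latticeChar, latticeChar, ← Complex.exp_add]
  congr 1
  push_cast [Prod.fst_add, Prod.snd_add]
  ring

@[simp] lemma latticeChar_zero (t : ℝ × ℝ) : latticeChar t (0, 0) = 1 := by
  simp [latticeChar]

lemma norm_latticeChar (t : ℝ × ℝ) (x : ℤ × ℤ) : ‖latticeChar t x‖ = 1 :=
  Complex.norm_exp_ofReal_mul_I _

lemma re_latticeChar (t : ℝ × ℝ) (x : ℤ × ℤ) :
    (latticeChar t x).re = Real.cos (t.1 * x.1 + t.2 * x.2) :=
  Complex.exp_ofReal_mul_I_re _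

/-- Characteristic function of the step away from the origin. -/
noncomputable def stepChar (t : ℝ × ℝ) : ℝ :=
  1 - 2 * cZeta * (cosDefect t.1 + cosDefect t.2)

/-- Characteristic function of the nearest-neighbour step. -/
noncomputable def nnChar (t : ℝ × ℝ) : ℝ := (Real.cos t.1 + Real.cos t.2) / 2

lemma integrable_latticeChar {Ω : Type*} [MeasurableSpace Ω] (μ : Measure Ω) [IsFiniteMeasure μ]
    {X : Ω → ℤ × ℤ} (hX : Measurable X) (t : ℝ × ℝ) :
    Integrable (fun ω => latticeChar t (X ω)) μ :=
  Integrable.of_bound ((measurable_of_countable (latticeChar t)).comp hX).aestronglyMeasurable 1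
    (Eventually.of_forall fun _ => (norm_latticeChar _ _).le)

/-- If, on the event `A`, the variable `X` takes the distinct values `y i` with conditional
probabilities `w i` of total mass one, then integrals over `A` are sums over the `y i`. -/
lemma hasSum_setIntegral_latticeChar {Ω : Type*} [MeasurableSpace Ω] {μ : Measure Ω}
    [IsFiniteMeasure μ] {X : Ω → ℤ × ℤ} (hX : Measurable X) {A : Set Ω} (hA : MeasurableSet A)
    {ι : Type*} [Countable ι] {y : ι → ℤ × ℤ} (hy : Function.Injective y) {w : ι → ℝ≥0∞}
    (hw : ∑' i, w i = 1) (h : ∀ i, μ ({ω | X ω = y i} ∩ A) = w i * μ A) (t : ℝ × ℝ) :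
    HasSum (fun i => ((w i).toReal * μ.real A : ℝ) * latticeChar t (y i))
      (∫ ω in A, latticeChar t (X ω) ∂μ) := by
  have hm : ∀ i, MeasurableSet ({ω | X ω = y i} ∩ A) := fun i =>
    (hX (measurableSet_singleton (y i))).inter hA
  have hd : Pairwise (Function.onFun Disjoint fun i => {ω | X ω = y i} ∩ A) := by
    intro i j hij
    refine Set.disjoint_left.2 fun ω hi hj => hij (hy ?_)
    exact hi.1.symm.trans hj.1
  have hU : (⋃ i, {ω | X ω = y i} ∩ A) =ᵐ[μ] A := by
    refine ae_eq_of_subset_of_measure_ge (Set.iUnion_subset fun i => Set.inter_subset_right) ?_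
      (MeasurableSet.iUnion hm).nullMeasurableSet (measure_ne_top _ _)
    rw [measure_iUnion hd hm]
    simp_rw [h]
    rw [ENNReal.tsum_mul_right, hw, one_mul]
  have := hasSum_integral_iUnion (f := fun ω => latticeChar t (X ω)) hm hd
    (integrable_latticeChar μ hX t).integrableOn
  rw [setIntegral_congr_set hU] at this
  refine hasSum_of_eq this fun i => ?_
  rw [setIntegral_congr_fun (g := fun _ => latticeChar t (y i)) (hm i)
    (fun ω hω => by simp only [show X ω = y i from hω.1]), setIntegral_const, Complex.real_smul]
  simp only [Measure.real, h i, ENNReal.toReal_mul]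

/-- A transition rule given on all histories ending at `x` holds on the event of being at `x`. -/
lemma measure_inter_of_prefixEvent {Ω : Type*} [MeasurableSpace Ω] {P : Measure Ω}
    {S : ℕ → Ω → ℤ × ℤ} (hmeas : ∀ n, Measurable (S n)) {n : ℕ} {x : ℤ × ℤ} {B : Set Ω}
    (hB : MeasurableSet B) {q : ℝ≥0∞}
    (h : ∀ h : ℕ → ℤ × ℤ, h n = x → P (B ∩ prefixEvent S n h) = q * P (prefixEvent S n h)) :
    P (B ∩ {ω | S n ω = x}) = q * P {ω | S n ω = x} := by
  let H : (Fin n → ℤ × ℤ) → ℕ → ℤ × ℤ := fun T k => if hk : k < n then T ⟨k, hk⟩ else x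
  have hHn : ∀ T, H T n = x := fun T => by simp [H]
  have hm : ∀ T, MeasurableSet (prefixEvent S n (H T)) := fun T => by
    have : prefixEvent S n (H T) = ⋂ k, ⋂ (_ : k ≤ n), {ω | S k ω = H T k} := by
      ext; simp [prefixEvent]
    rw [this]
    exact MeasurableSet.iInter fun k => MeasurableSet.iInter fun _ =>
      hmeas k (measurableSet_singleton _)
  have hd : Pairwise (Function.onFun Disjoint fun T => prefixEvent S n (H T)) := by
    intro T T' hT
    refine Set.disjoint_left.2 fun ω h1 h2 => hT (funext fun k => ?_)
    have := (h1 k k.2.le).symm.trans (h2 k k.2.le)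
    simpa [H] using this
  have hU : {ω | S n ω = x} = ⋃ T, prefixEvent S n (H T) := by
    ext ω
    simp only [Set.mem_ofPred_eq, Set.mem_iUnion, prefixEvent]
    constructor
    · intro hω
      refine ⟨fun k => S k ω, fun k hk => ?_⟩
      rcases hk.lt_or_eq with hk | rfl
      · simp [H, hk]
      · simpa [H] using hω
    · rintro ⟨T, hT⟩
      rw [hT n le_rfl, hHn]
  rw [hU, Set.inter_iUnion, measure_iUnion hd hm, measure_iUnion _ fun T => hB.inter (hm T),
    ← ENNReal.tsum_mul_left]
  · exact tsum_congr fun T => h _ (hHn T)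
  · exact fun T T' hT => (hd hT).mono Set.inter_subset_right Set.inter_subset_right

lemma sum_nbrs {M : Type*} [AddCommMonoid M] (f : ℤ × ℤ → M) :
    ∑ v : nbrs, f v = f (1, 0) + f (-1, 0) + f (0, 1) + f (0, -1) := by
  rw [Finset.sum_coe_sort nbrs f]
  simp [nbrs, Finset.sum_insert, add_assoc]

lemma hasSum_cos_series (θ : ℝ) :
    HasSum (fun m : ℕ => cZeta / ((m : ℝ) + 1) ^ 3 * Real.cos ((m + 1) * θ))
      (1 / 4 - cZeta * cosDefect θ) := by
  have h := (summable_inv_succ_cube.hasSum.sub (summable_cosDefect θ).hasSum).mul_left cZeta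
  have e : (1 / 4 - cZeta * cosDefect θ) = cZeta *
      (∑' m : ℕ, 1 / ((m : ℝ) + 1) ^ 3 -
        ∑' m : ℕ, (1 - Real.cos ((m + 1) * θ)) / ((m : ℝ) + 1) ^ 3) := by
    rw [← cZeta_mul_zeta3, mul_sub]; rfl
  rw [e]
  refine hasSum_of_eq h fun m => ?_
  ring

lemma hasSum_exp_series (θ : ℝ) :
    HasSum (fun m : ℕ => ((cZeta / ((m : ℝ) + 1) ^ 3 : ℝ) : ℂ) *
        (Complex.exp ((((m + 1) * θ : ℝ) : ℂ) * Complex.I)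
          + Complex.exp (((-((m + 1) * θ) : ℝ) : ℂ) * Complex.I)))
      (2 * (1 / 4 - cZeta * cosDefect θ) : ℝ) := by
  have h := (hasSum_cos_series θ).mul_left 2
  have h' := Complex.hasSum_ofReal.2 h
  refine hasSum_of_eq h' fun m => ?_
  have : Complex.exp ((((m + 1) * θ : ℝ) : ℂ) * Complex.I)
      + Complex.exp (((-((m + 1) * θ) : ℝ) : ℂ) * Complex.I)
      = ((2 * Real.cos ((m + 1) * θ) : ℝ) : ℂ) := by
    push_cast
    rw [Complex.two_cos, neg_mul]
  rw [this, ← Complex.ofReal_mul]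
  congr 1
  ring

lemma tsum_stepWeight :
    ∑' i : nbrs × ℕ, ENNReal.ofReal (cZeta / ((i.2 : ℝ) + 1) ^ 3) = 1 := by
  have h := hasSum_cos_series 0
  simp only [mul_zero, Real.cos_zero, mul_one, cosDefect_zero, sub_zero] at h
  have h1 : ∑' m : ℕ, ENNReal.ofReal (cZeta / ((m : ℝ) + 1) ^ 3) = ENNReal.ofReal (1 / 4) := by
    rw [← h.tsum_eq, ENNReal.ofReal_tsum_of_nonneg _ h.summable]
    have := cZeta_pos
    intro m; positivity
  rw [ENNReal.tsum_prod
    (f := fun (_ : nbrs) (m : ℕ) => ENNReal.ofReal (cZeta / ((m : ℝ) + 1) ^ 3)), tsum_fintype]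
  simp_rw [h1]
  have : Fintype.card nbrs = 4 := rfl
  rw [Finset.sum_const, Finset.card_univ, this, nsmul_eq_mul]
  rw [← ENNReal.ofReal_natCast, ← ENNReal.ofReal_mul (by norm_num)]
  norm_num

lemma injective_smul_nbrs (x : ℤ × ℤ) :
    Function.Injective fun i : nbrs × ℕ => x + (i.2 + 1) • (i.1 : ℤ × ℤ) := by
  rintro ⟨⟨v, hv⟩, m⟩ ⟨⟨v', hv'⟩, m'⟩ h
  simp only [add_right_inj] at h
  simp only [nbrs, Finset.mem_insert, Finset.mem_singleton] at hv hv'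
  rcases hv with rfl | rfl | rfl | rfl <;> rcases hv' with rfl | rfl | rfl | rfl <;>
    simp [Prod.ext_iff] at h ⊢ <;> omega

section Chain

variable {Ω : Type*} [MeasurableSpace Ω] {P : Measure Ω} [IsProbabilityMeasure P]
  {S : ℕ → Ω → ℤ × ℤ}

lemma setIntegral_step_of_ne_zero (hmeas : ∀ n, Measurable (S n))
    (hMarkov : ∀ (n : ℕ) (h : ℕ → ℤ × ℤ), h n ≠ (0, 0) → ∀ m : ℕ, 1 ≤ m →
      ∀ v ∈ nbrs,
      P ({ω | S (n + 1) ω = h n + m • v} ∩ prefixEvent S n h)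
        = ENNReal.ofReal (cZeta / (m : ℝ) ^ 3) * P (prefixEvent S n h))
    (n : ℕ) {x : ℤ × ℤ} (hx : x ≠ (0, 0)) (t : ℝ × ℝ) :
    ∫ ω in {ω | S n ω = x}, latticeChar t (S (n + 1) ω) ∂P
      = stepChar t * (P.real {ω | S n ω = x} * latticeChar t x) := by
  have hA : MeasurableSet {ω | S n ω = x} := hmeas n (measurableSet_singleton x)
  have key := hasSum_setIntegral_latticeChar (μ := P) (hmeas (n + 1)) hA
    (injective_smul_nbrs x) tsum_stepWeight (fun i => measure_inter_of_prefixEvent hmeas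
      (hmeas (n + 1) (measurableSet_singleton _)) fun h hh => by
        have := hMarkov n h (hh ▸ hx) (i.2 + 1) (by omega) i.1 i.1.2
        rw [hh] at this
        push_cast at this
        exact this) t
  set a := P.real {ω | S n ω = x} with ha
  have hfib : ∀ v : nbrs, Summable fun m : ℕ =>
      (((ENNReal.ofReal (cZeta / ((m : ℝ) + 1) ^ 3)).toReal * a : ℝ) : ℂ) *
        latticeChar t (x + (m + 1) • (v : ℤ × ℤ)) := fun v => key.summable.prod_factor v
  have h1 := key.prod_fiberwise fun v => (hfib v).hasSum
  have h2 := h1.unique (hasSum_fintype _)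
  have hpos : ∀ m : ℕ, 0 ≤ cZeta / ((m : ℝ) + 1) ^ 3 := fun m => by
    have := cZeta_pos
    positivity
  have hsum : HasSum (fun m : ℕ => ∑ v : nbrs,
      (((ENNReal.ofReal (cZeta / ((m : ℝ) + 1) ^ 3)).toReal * a : ℝ) : ℂ) *
        latticeChar t (x + (m + 1) • (v : ℤ × ℤ)))
      (∫ ω in {ω | S n ω = x}, latticeChar t (S (n + 1) ω) ∂P) := by
    rw [h2]
    exact hasSum_sum fun v _ => (hfib v).hasSum
  have hexp := ((hasSum_exp_series t.1).add (hasSum_exp_series t.2)).mul_left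
    ((a : ℂ) * latticeChar t x)
  have e : (stepChar t : ℂ) * (a * latticeChar t x) = (a : ℂ) * latticeChar t x *
      (((2 * (1 / 4 - cZeta * cosDefect t.1) : ℝ) : ℂ) +
        ((2 * (1 / 4 - cZeta * cosDefect t.2) : ℝ) : ℂ)) := by
    rw [stepChar]; push_cast; ring
  rw [e]
  refine hsum.unique (hasSum_of_eq hexp fun m => ?_)
  rw [ENNReal.toReal_ofReal (hpos m), sum_nbrs fun v =>
    ((cZeta / ((m : ℝ) + 1) ^ 3 * a : ℝ) : ℂ) * latticeChar t (x + (m + 1) • v)]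
  simp_rw [latticeChar_add]
  have f1 : latticeChar t ((m + 1) • (1, 0)) =
      Complex.exp ((((m + 1) * t.1 : ℝ) : ℂ) * Complex.I) := by
    simp [latticeChar, mul_comm]
  have f2 : latticeChar t ((m + 1) • (-1, 0)) =
      Complex.exp (((-((m + 1) * t.1) : ℝ) : ℂ) * Complex.I) := by
    simp [latticeChar]; ring_nf
  have f3 : latticeChar t ((m + 1) • (0, 1)) =
      Complex.exp ((((m + 1) * t.2 : ℝ) : ℂ) * Complex.I) := by
    simp [latticeChar, mul_comm]
  have f4 : latticeChar t ((m + 1) • (0, -1)) =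
      Complex.exp (((-((m + 1) * t.2) : ℝ) : ℂ) * Complex.I) := by
    simp [latticeChar]; ring_nf
  rw [f1, f2, f3, f4]
  push_cast
  ring

lemma setIntegral_step_zero (hmeas : ∀ n, Measurable (S n))
    (hOrigin : ∀ (n : ℕ) (h : ℕ → ℤ × ℤ), h n = (0, 0) → ∀ v ∈ nbrs,
      P ({ω | S (n + 1) ω = h n + v} ∩ prefixEvent S n h)
        = (1/4) * P (prefixEvent S n h))
    (n : ℕ) (t : ℝ × ℝ) :
    ∫ ω in {ω | S n ω = (0, 0)}, latticeChar t (S (n + 1) ω) ∂P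
      = nnChar t * P.real {ω | S n ω = (0, 0)} := by
  have hA : MeasurableSet {ω | S n ω = (0, 0)} := hmeas n (measurableSet_singleton _)
  have hw : ∑' _ : nbrs, (1 / 4 : ℝ≥0∞) = 1 := by
    have : Fintype.card nbrs = 4 := rfl
    rw [tsum_fintype, Finset.sum_const, Finset.card_univ, this, nsmul_eq_mul]
    exact ENNReal.mul_div_cancel (by norm_num) (by norm_num)
  have key := hasSum_setIntegral_latticeChar (μ := P) (y := fun v : nbrs => (v : ℤ × ℤ))
    (hmeas (n + 1)) hA Subtype.val_injective hw
    (fun i => measure_inter_of_prefixEvent hmeas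
      (hmeas (n + 1) (measurableSet_singleton _)) fun h hh => by
        have := hOrigin n h hh i i.2
        rw [hh] at this
        rw [show ((0, 0) : ℤ × ℤ) + i = i from zero_add _] at this
        exact this) t
  rw [key.unique (hasSum_fintype _), sum_nbrs fun v =>
    (((1 / 4 : ℝ≥0∞).toReal * P.real {ω | S n ω = (0, 0)} : ℝ) : ℂ) * latticeChar t v]
  have hq : (1 / 4 : ℝ≥0∞).toReal = 1 / 4 := by simp
  rw [hq, nnChar]
  simp only [latticeChar]
  push_cast
  rw [Complex.cos, Complex.cos]
  simp
  ring

lemma integral_latticeChar_succ (hmeas : ∀ n, Measurable (S n))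
    (hOrigin : ∀ (n : ℕ) (h : ℕ → ℤ × ℤ), h n = (0, 0) → ∀ v ∈ nbrs,
      P ({ω | S (n + 1) ω = h n + v} ∩ prefixEvent S n h)
        = (1/4) * P (prefixEvent S n h))
    (hMarkov : ∀ (n : ℕ) (h : ℕ → ℤ × ℤ), h n ≠ (0, 0) → ∀ m : ℕ, 1 ≤ m →
      ∀ v ∈ nbrs,
      P ({ω | S (n + 1) ω = h n + m • v} ∩ prefixEvent S n h)
        = ENNReal.ofReal (cZeta / (m : ℝ) ^ 3) * P (prefixEvent S n h))
    (n : ℕ) (t : ℝ × ℝ) :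
    ∫ ω, latticeChar t (S (n + 1) ω) ∂P = stepChar t * ∫ ω, latticeChar t (S n ω) ∂P
      + (nnChar t - stepChar t) * P.real {ω | S n ω = (0, 0)} := by
  have hm : ∀ x, MeasurableSet {ω | S n ω = x} := fun x => hmeas n (measurableSet_singleton x)
  have hd : Pairwise (Function.onFun Disjoint fun x => {ω | S n ω = x}) := fun x y hxy =>
    Set.disjoint_left.2 fun ω h1 h2 => hxy (h1.symm.trans h2)
  have hU : (⋃ x, {ω | S n ω = x}) = Set.univ := by ext; simp
  have h1 := hasSum_integral_iUnion (f := fun ω => latticeChar t (S (n + 1) ω)) hm hd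
    (integrable_latticeChar P (hmeas (n + 1)) t).integrableOn
  have h0 := hasSum_integral_iUnion (f := fun ω => latticeChar t (S n ω)) hm hd
    (integrable_latticeChar P (hmeas n) t).integrableOn
  rw [hU, setIntegral_univ] at h1 h0
  have hS : ∀ x, ∫ ω in {ω | S n ω = x}, latticeChar t (S n ω) ∂P
      = P.real {ω | S n ω = x} * latticeChar t x := fun x => by
    rw [setIntegral_congr_fun (g := fun _ => latticeChar t x) (hm x)
      (fun ω hω => by simp only [show S n ω = x from hω]), setIntegral_const, Complex.real_smul]
  have h2 := h1.sub (h0.mul_left (stepChar t : ℂ))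
  have h3 := hasSum_ite_eq ((0, 0) : ℤ × ℤ)
    (((nnChar t : ℂ) - stepChar t) * P.real {ω | S n ω = (0, 0)})
  have h4 := h2.unique (hasSum_of_eq h3 fun x => ?_)
  · linear_combination h4
  · rw [hS x]
    split_ifs with hx
    · subst hx
      rw [setIntegral_step_zero hmeas hOrigin]
      simp
      ring
    · rw [setIntegral_step_of_ne_zero hmeas hMarkov n hx, sub_self]

end Chain

lemma stepChar_le_one (t : ℝ × ℝ) : stepChar t ≤ 1 := by
  have := cZeta_pos
  have h1 := cosDefect_nonneg t.1
  have h2 := cosDefect_nonneg t.2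
  have : 0 ≤ 2 * cZeta * (cosDefect t.1 + cosDefect t.2) := by positivity
  unfold stepChar
  linarith

lemma neg_one_le_stepChar (t : ℝ × ℝ) : -1 ≤ stepChar t := by
  have h1 := mul_le_mul_of_nonneg_left (cosDefect_le t.1) cZeta_pos.le
  have h2 := mul_le_mul_of_nonneg_left (cosDefect_le t.2) cZeta_pos.le
  unfold stepChar
  linarith [cZeta_mul_zeta3]

lemma one_sub_nnChar_le (t : ℝ × ℝ) :
    1 - nnChar t ≤ (cosDefect t.1 + cosDefect t.2) / 2 := by
  have h1 := one_sub_cos_le_cosDefect t.1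
  have h2 := one_sub_cos_le_cosDefect t.2
  unfold nnChar
  linarith

lemma nnChar_le_one (t : ℝ × ℝ) : nnChar t ≤ 1 := by
  have h1 := Real.cos_le_one t.1
  have h2 := Real.cos_le_one t.2
  unfold nnChar
  linarith

lemma abs_nnChar_sub_stepChar_le (t : ℝ × ℝ) :
    |nnChar t - stepChar t| ≤ (2 * cZeta + 1 / 2) * (cosDefect t.1 + cosDefect t.2) := by
  have h1 := one_sub_nnChar_le t
  have h2 := nnChar_le_one t
  have h3 := stepChar_le_one t
  have h4 : 1 - stepChar t = 2 * cZeta * (cosDefect t.1 + cosDefect t.2) := by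
    unfold stepChar; ring
  rw [abs_le]
  constructor <;> linarith

/-- Orthogonality of the characters of `ℤ/N`. -/
lemma sum_cos_two_pi_div (N : ℕ) (hN : 0 < N) (x : ℤ) :
    ∑ j ∈ Finset.range N, Real.cos (2 * Real.pi * j / N * x)
      = if (N : ℤ) ∣ x then (N : ℝ) else 0 := by
  have hζ := Complex.isPrimitiveRoot_exp N hN.ne'
  set ζ := Complex.exp (2 * Real.pi * Complex.I / N) with hζdef
  have hterm : ∀ j : ℕ, Real.cos (2 * Real.pi * j / N * x) = ((ζ ^ x) ^ j).re := fun j => by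
    rw [hζdef, ← Complex.exp_int_mul, ← Complex.exp_nat_mul, ← Complex.exp_ofReal_mul_I_re]
    congr 2
    push_cast
    ring
  simp_rw [hterm]
  rw [← Complex.re_sum]
  split_ifs with h
  · rw [(hζ.zpow_eq_one_iff_dvd x).2 h]
    simp
  · have h1 : ζ ^ x ≠ 1 := fun h' => h ((hζ.zpow_eq_one_iff_dvd x).1 h')
    have h2 : (ζ ^ x) ^ N = 1 := by
      rw [← zpow_natCast, ← zpow_mul, mul_comm, zpow_mul, zpow_natCast, hζ.pow_eq_one, one_zpow]
    rw [geom_sum_eq h1, h2]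
    simp

section Visits

variable {Ω : Type*} [MeasurableSpace Ω] {P : Measure Ω} [IsProbabilityMeasure P]
  {S : ℕ → Ω → ℤ × ℤ}

lemma norm_integral_latticeChar_le (n : ℕ) (t : ℝ × ℝ) :
    ‖∫ ω, latticeChar t (S n ω) ∂P‖ ≤ 1 := by
  refine (norm_integral_le_of_norm_le_const (C := 1)
    (Eventually.of_forall fun ω => (norm_latticeChar _ _).le)).trans ?_
  simp

/-- Averaging the characteristic function over a cyclic group bounds the atom at the origin. -/
lemma mul_measureReal_zero_le (hmeas : ∀ n, Measurable (S n)) (N : ℕ) (hN : 0 < N) (k : ℕ) :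
    (N : ℝ) * P.real {ω | S k ω = (0, 0)} ≤
      ∑ j ∈ Finset.range N, (∫ ω, latticeChar (2 * Real.pi * j / N, 0) (S k ω) ∂P).re := by
  have hint : ∀ j : ℕ, Integrable
      (fun ω => (latticeChar (2 * Real.pi * j / N, 0) (S k ω)).re) P := fun j =>
    (integrable_latticeChar P (hmeas k) _).re
  have hre : ∀ j : ℕ, (∫ ω, latticeChar (2 * Real.pi * j / N, 0) (S k ω) ∂P).re
      = ∫ ω, (latticeChar (2 * Real.pi * j / N, 0) (S k ω)).re ∂P := fun j =>
    (integral_re (integrable_latticeChar P (hmeas k) _)).symm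
  simp_rw [hre]
  rw [← integral_finsetSum _ fun j _ => hint j]
  have hA : MeasurableSet {ω | S k ω = (0, 0)} := hmeas k (measurableSet_singleton _)
  have : (N : ℝ) * P.real {ω | S k ω = (0, 0)}
      = ∫ ω, {ω | S k ω = (0, 0)}.indicator (fun _ => (N : ℝ)) ω ∂P := by
    rw [integral_indicator_const _ hA, smul_eq_mul, mul_comm]
  rw [this]
  refine integral_mono ((integrable_const _).indicator hA)
    (integrable_finsetSum _ fun j _ => hint j) fun ω => ?_
  simp only [re_latticeChar, zero_mul, add_zero]
  rw [sum_cos_two_pi_div N hN]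
  by_cases h : S k ω = (0, 0)
  · simp [Set.indicator, h]
  · simp only [Set.indicator, Set.mem_ofPred_eq, h, if_false]
    split_ifs <;> simp

/-- The expected proportion of time spent at the origin tends to zero. -/
lemma tendsto_visits_div (hmeas : ∀ n, Measurable (S n))
    (hrec : ∀ n t, ∫ ω, latticeChar t (S (n + 1) ω) ∂P
      = stepChar t * ∫ ω, latticeChar t (S n ω) ∂P
        + (nnChar t - stepChar t) * P.real {ω | S n ω = (0, 0)}) :
    Tendsto (fun n : ℕ => (∑ k ∈ Finset.range n, P.real {ω | S k ω = (0, 0)}) / n) atTop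
      (𝓝 0) := by
  set p : ℕ → ℝ := fun k => P.real {ω | S k ω = (0, 0)} with hp
  set u : ℕ → ℝ × ℝ → ℝ := fun k t => (∫ ω, latticeChar t (S k ω) ∂P).re with hu
  have hp0 : ∀ n, 0 ≤ ∑ k ∈ Finset.range n, p k := fun n =>
    Finset.sum_nonneg fun k _ => measureReal_nonneg
  have hurec : ∀ n t, u (n + 1) t = stepChar t * u n t + (nnChar t - stepChar t) * p n := by
    intro n t
    simp only [hu, hp, hrec n t]
    rw [← Complex.ofReal_sub, ← Complex.ofReal_mul, Complex.add_re, Complex.re_ofReal_mul,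
      Complex.ofReal_re]
  have hu1 : ∀ n t, |u n t| ≤ 1 := fun n t =>
    (Complex.abs_re_le_norm _).trans (norm_integral_latticeChar_le n t)
  have hsum : ∀ n t, (1 - stepChar t) * ∑ k ∈ Finset.range n, u k t
      ≤ (nnChar t - stepChar t) * (∑ k ∈ Finset.range n, p k) + 2 := by
    intro n t
    have h : (1 - stepChar t) * ∑ k ∈ Finset.range n, u k t
        = (nnChar t - stepChar t) * (∑ k ∈ Finset.range n, p k) + (u 0 t - u n t) := by
      induction n with
      | zero => simp
      | succ n ih =>
        rw [Finset.sum_range_succ, Finset.sum_range_succ, mul_add, mul_add, ih, hurec]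
        ring
    have h0 := abs_le.1 (hu1 0 t)
    have hn := abs_le.1 (hu1 n t)
    linarith [h0.2, hn.1]
  have hbound : ∀ N : ℕ, 2 ≤ N → ∃ K : ℝ, ∀ n : ℕ,
      (N : ℝ) / 4 * (∑ k ∈ Finset.range n, p k) ≤ n + K := by
    intro N hN
    have hN0 : 0 < N := by omega
    let τ : ℕ → ℝ × ℝ := fun j => (2 * Real.pi * j / N, 0)
    refine ⟨∑ j ∈ Finset.range (N - 1), 2 / (1 - stepChar (τ (j + 1))), fun n => ?_⟩
    set Q := ∑ k ∈ Finset.range n, p k with hQ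
    have hQ0 : 0 ≤ Q := hp0 n
    have hNQ : (N : ℝ) * Q ≤ ∑ j ∈ Finset.range N, ∑ k ∈ Finset.range n, u k (τ j) := by
      rw [Finset.sum_comm, hQ, Finset.mul_sum]
      exact Finset.sum_le_sum fun k _ => mul_measureReal_zero_le hmeas N hN0 k
    have hsplit : ∀ f : ℕ → ℝ, ∑ j ∈ Finset.range N, f j
        = (∑ j ∈ Finset.range (N - 1), f (j + 1)) + f 0 := fun f => by
      rw [← Finset.sum_range_succ', Nat.sub_add_cancel hN0]
    have hcos := sum_cos_two_pi_div N hN0 1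
    rw [if_neg (by
      intro h
      have := Int.le_of_dvd one_pos h
      omega), hsplit] at hcos
    simp only [Int.cast_one, mul_one, Nat.cast_zero, mul_zero, zero_div, Real.cos_zero] at hcos
    have h0 : ∑ k ∈ Finset.range n, u k (τ 0) ≤ n := by
      calc _ ≤ ∑ k ∈ Finset.range n, (1 : ℝ) :=
            Finset.sum_le_sum fun k _ => (le_abs_self _).trans (hu1 k _)
        _ = n := by simp
    have hj : ∀ j ∈ Finset.range (N - 1), ∑ k ∈ Finset.range n, u k (τ (j + 1))
        ≤ Q - (1 - Real.cos (2 * Real.pi * (j + 1 : ℕ) / N)) / 4 * Q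
          + 2 / (1 - stepChar (τ (j + 1))) := by
      intro j hj
      have hjN : j + 1 < N := by have := Finset.mem_range.1 hj; omega
      have hNr : (0 : ℝ) < N := by exact_mod_cast hN0
      have hjr : ((j + 1 : ℕ) : ℝ) < N := by exact_mod_cast hjN
      have hj0 : (0 : ℝ) < ((j + 1 : ℕ) : ℝ) := by positivity
      set θ := 2 * Real.pi * (j + 1 : ℕ) / N with hθ
      have hcos1 : Real.cos θ < 1 := by
        refine lt_of_le_of_ne (Real.cos_le_one _) fun h => ?_
        have hθ0 : 0 < θ := by positivity
        have hθ1 : θ < 2 * Real.pi := by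
          rw [hθ, div_lt_iff₀ hNr]
          have := Real.pi_pos
          gcongr
        rw [Real.cos_eq_one_iff_of_lt_of_lt (by linarith [Real.pi_pos]) hθ1] at h
        exact hθ0.ne' h
      have hd : 0 < 1 - stepChar (τ (j + 1)) := by
        have := one_sub_cos_le_cosDefect θ
        have h2 : 0 < 2 * cZeta * (cosDefect θ + cosDefect 0) := by
          have := cZeta_pos
          rw [cosDefect_zero, add_zero]
          have : 0 < cosDefect θ := by linarith
          positivity
        have h3 : 1 - stepChar (τ (j + 1)) = 2 * cZeta * (cosDefect θ + cosDefect 0) := by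
          simp only [stepChar, τ]; ring
        rw [h3]; exact h2
      have hs := hsum n (τ (j + 1))
      have hlow := neg_one_le_stepChar (τ (j + 1))
      have hnn : nnChar (τ (j + 1)) = 1 - (1 - Real.cos θ) / 2 := by
        simp only [nnChar, τ, Real.cos_zero]; ring
      rw [hnn] at hs
      set d := 1 - stepChar (τ (j + 1)) with hd_def
      refine le_of_mul_le_mul_left ?_ hd
      refine hs.trans ?_
      rw [mul_add, mul_div_cancel₀ _ hd.ne']
      have : 0 ≤ (1 - Real.cos θ) * Q * (2 - d) :=
        mul_nonneg (mul_nonneg (by linarith) hQ0) (by linarith)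
      have e : 1 - (1 - Real.cos θ) / 2 - stepChar (τ (j + 1)) = d - (1 - Real.cos θ) / 2 := by
        rw [hd_def]; ring
      rw [e]
      nlinarith
    have hall := hNQ
    rw [hsplit] at hall
    have hall2 := hall.trans (add_le_add (Finset.sum_le_sum hj) h0)
    have hcard : ((N - 1 : ℕ) : ℝ) = N - 1 := by
      rw [Nat.cast_sub hN0, Nat.cast_one]
    rw [Finset.sum_add_distrib, Finset.sum_sub_distrib, ← Finset.sum_mul, ← Finset.sum_div,
      Finset.sum_sub_distrib] at hall2
    simp only [Finset.sum_const, Finset.card_range, nsmul_eq_mul, hcard] at hall2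
    have hc' : ∑ j ∈ Finset.range (N - 1), Real.cos (2 * Real.pi * (j + 1 : ℕ) / N) = -1 := by
      linarith
    rw [hc'] at hall2
    nlinarith
  rw [Metric.tendsto_atTop]
  intro ε hε
  obtain ⟨N, hN⟩ := exists_nat_gt (8 / ε)
  obtain ⟨K, hK⟩ := hbound (N + 2) (by omega)
  obtain ⟨n₀, hn₀⟩ := exists_nat_gt K
  refine ⟨n₀ + 1, fun n hn => ?_⟩
  have hnn : ((n₀ + 1 : ℕ) : ℝ) ≤ n := by exact_mod_cast hn
  push_cast at hnn
  have hn0 : (0 : ℝ) < n := by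
    have : (0 : ℝ) ≤ n₀ := Nat.cast_nonneg _
    linarith
  rw [Real.dist_eq, sub_zero, abs_of_nonneg (div_nonneg (hp0 n) hn0.le), div_lt_iff₀ hn0]
  have h := hK n
  rw [div_lt_iff₀ hε] at hN
  push_cast at h
  by_contra! hcon
  have h3 : ((N : ℝ) + 2) / 4 * (ε * n) ≤ n + K := le_trans (by gcongr) h
  nlinarith

/-- Convergence of the characteristic functions. -/
lemma tendsto_integral_latticeChar (hmeas : ∀ n, Measurable (S n))
    (hS0 : ∀ᵐ ω ∂P, S 0 ω = (0, 0))
    (hrec : ∀ n t, ∫ ω, latticeChar t (S (n + 1) ω) ∂P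
      = stepChar t * ∫ ω, latticeChar t (S n ω) ∂P
        + (nnChar t - stepChar t) * P.real {ω | S n ω = (0, 0)}) (s : ℝ × ℝ) :
    Tendsto (fun n : ℕ => ∫ ω, latticeChar ((Real.sqrt (n * Real.log n))⁻¹ • s) (S n ω) ∂P) atTop
      (𝓝 (Real.exp (-(cZeta * (s.1 ^ 2 + s.2 ^ 2) / 2)) : ℝ)) := by
  set p : ℕ → ℝ := fun k => P.real {ω | S k ω = (0, 0)} with hp
  have hbase : ∀ t, ∫ ω, latticeChar t (S 0 ω) ∂P = 1 := fun t => by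
    rw [integral_congr_ae (g := fun _ => (1 : ℂ)) (hS0.mono fun ω hω => by simp [hω])]
    simp
  have hdiff : ∀ (n : ℕ) (t : ℝ × ℝ), ‖(∫ ω, latticeChar t (S n ω) ∂P) - (stepChar t : ℂ) ^ n‖
      ≤ |nnChar t - stepChar t| * ∑ k ∈ Finset.range n, p k := by
    intro n t
    induction n with
    | zero => simp [hbase]
    | succ n ih =>
      have e : (∫ ω, latticeChar t (S (n + 1) ω) ∂P) - (stepChar t : ℂ) ^ (n + 1)
          = stepChar t * ((∫ ω, latticeChar t (S n ω) ∂P) - (stepChar t : ℂ) ^ n)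
            + ((nnChar t - stepChar t : ℝ) : ℂ) * (p n : ℂ) := by
        rw [hrec]; push_cast; ring
      rw [e, Finset.sum_range_succ, mul_add]
      refine (norm_add_le _ _).trans (add_le_add ?_ ?_)
      · rw [norm_mul, Complex.norm_real, Real.norm_eq_abs]
        have : |stepChar t| ≤ 1 := abs_le.2 ⟨neg_one_le_stepChar t, stepChar_le_one t⟩
        exact (mul_le_of_le_one_left (norm_nonneg _) this).trans ih
      · rw [norm_mul, Complex.norm_real, Complex.norm_real, Real.norm_eq_abs, Real.norm_eq_abs,
          abs_of_nonneg (measureReal_nonneg : 0 ≤ p n)]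
  set τ : ℕ → ℝ × ℝ := fun n => (Real.sqrt (n * Real.log n))⁻¹ • s with hτ
  have hD : Tendsto (fun n : ℕ => (n : ℝ) * (cosDefect (τ n).1 + cosDefect (τ n).2)) atTop
      (𝓝 (s.1 ^ 2 / 4 + s.2 ^ 2 / 4)) := by
    simp_rw [mul_add]
    exact (tendsto_mul_cosDefect s.1).add (tendsto_mul_cosDefect s.2)
  have hpow : Tendsto (fun n : ℕ => stepChar (τ n) ^ n) atTop
      (𝓝 (Real.exp (-(cZeta * (s.1 ^ 2 + s.2 ^ 2) / 2)))) := by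
    have hg : Tendsto (fun n : ℕ => (n : ℝ) * (stepChar (τ n) - 1)) atTop
        (𝓝 (-(cZeta * (s.1 ^ 2 + s.2 ^ 2) / 2))) := by
      have := hD.const_mul (-(2 * cZeta))
      convert this using 1
      · ext n; simp only [stepChar]; ring
      · congr 1; ring
    simpa using Real.tendsto_one_add_pow_exp_of_tendsto hg
  have herr : Tendsto (fun n : ℕ => (∫ ω, latticeChar (τ n) (S n ω) ∂P)
      - ((stepChar (τ n) ^ n : ℝ) : ℂ)) atTop (𝓝 0) := by
    have hmul := (hD.const_mul (2 * cZeta + 1 / 2)).mul (tendsto_visits_div hmeas hrec)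
    rw [mul_zero] at hmul
    refine squeeze_zero_norm' ?_ hmul
    filter_upwards [eventually_gt_atTop 0] with n hn
    have hn' : (0 : ℝ) < n := by exact_mod_cast hn
    push_cast
    refine (hdiff n (τ n)).trans ?_
    have hQ : 0 ≤ ∑ k ∈ Finset.range n, p k := Finset.sum_nonneg fun k _ => measureReal_nonneg
    refine (mul_le_mul_of_nonneg_right (abs_nnChar_sub_stepChar_le _) hQ).trans (le_of_eq ?_)
    simp only [hp]
    field_simp
  have hfin := herr.add ((Complex.continuous_ofReal.tendsto _).comp hpow)
  rw [zero_add] at hfin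
  exact hfin.congr fun n => sub_add_cancel _ _

end Visits

/-- Lévy's continuity theorem on `ℝ × ℝ` with a Gaussian limit. -/
lemma tendsto_integral_gauss2 {Ω : Type*} [MeasurableSpace Ω] {P : Measure Ω}
    [IsProbabilityMeasure P] {X : ℕ → Ω → ℝ × ℝ} (hX : ∀ n, Measurable (X n)) (v : ℝ≥0)
    (h : ∀ s : ℝ × ℝ, Tendsto (fun n => ∫ ω,
      Complex.exp (((s.1 * (X n ω).1 + s.2 * (X n ω).2 : ℝ) : ℂ) * Complex.I) ∂P) atTop
      (𝓝 (Real.exp (-(v * (s.1 ^ 2 + s.2 ^ 2) / 2)) : ℝ)))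
    (f : BoundedContinuousFunction (ℝ × ℝ) ℝ) :
    Tendsto (fun n => ∫ ω, f (X n ω) ∂P) atTop (𝓝 (∫ x, f x ∂(gauss2 v))) := by
  have : IsProbabilityMeasure (gauss2 v) := by unfold gauss2; infer_instance
  have hL : Measurable (WithLp.toLp 2 : ℝ × ℝ → WithLp 2 (ℝ × ℝ)) := by fun_prop
  have hLX : ∀ n, Measurable fun ω => WithLp.toLp 2 (X n ω) := fun n => hL.comp (hX n)
  let μ : ℕ → ProbabilityMeasure (WithLp 2 (ℝ × ℝ)) := fun n =>
    ⟨P.map fun ω => WithLp.toLp 2 (X n ω),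
      Measure.isProbabilityMeasure_map (hLX n).aemeasurable⟩
  let μ₀ : ProbabilityMeasure (WithLp 2 (ℝ × ℝ)) :=
    ⟨(gauss2 v).map (WithLp.toLp 2), Measure.isProbabilityMeasure_map hL.aemeasurable⟩
  have hlim : Tendsto μ atTop (𝓝 μ₀) := by
    refine ProbabilityMeasure.tendsto_of_tendsto_charFun fun t => ?_
    have h0 : charFun (μ₀ : Measure (WithLp 2 (ℝ × ℝ))) t
        = (Real.exp (-(v * (t.ofLp.1 ^ 2 + t.ofLp.2 ^ 2) / 2)) : ℝ) := by
      change charFun ((gauss2 v).map (WithLp.toLp 2)) t = _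
      rw [gauss2, charFun_prod, charFun_gaussianReal, charFun_gaussianReal, ← Complex.exp_add]
      push_cast
      congr 1
      ring
    rw [h0]
    refine (h t.ofLp).congr fun n => ?_
    change _ = charFun (P.map fun ω => WithLp.toLp 2 (X n ω)) t
    rw [charFun, integral_map (hLX n).aemeasurable
      (by fun_prop)]
    refine integral_congr_ae (Eventually.of_forall fun ω => ?_)
    simp [WithLp.prod_inner_apply]
  rw [ProbabilityMeasure.tendsto_iff_forall_integral_tendsto] at hlim
  have hf := hlim (f.compContinuous ⟨WithLp.ofLp, WithLp.prod_continuous_ofLp 2 ℝ ℝ⟩)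
  have e0 : ∫ x, f.compContinuous ⟨WithLp.ofLp, WithLp.prod_continuous_ofLp 2 ℝ ℝ⟩ x
      ∂(μ₀ : Measure (WithLp 2 (ℝ × ℝ))) = ∫ x, f x ∂(gauss2 v) := by
    change ∫ x, _ ∂((gauss2 v).map (WithLp.toLp 2)) = _
    rw [integral_map hL.aemeasurable (BoundedContinuousFunction.continuous _).aestronglyMeasurable]
    rfl
  rw [e0] at hf
  refine hf.congr fun n => ?_
  change ∫ x, _ ∂(P.map fun ω => WithLp.toLp 2 (X n ω)) = _
  rw [integral_map (hLX n).aemeasurable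
    (BoundedContinuousFunction.continuous _).aestronglyMeasurable]
  rfl

/-- **CLT for the locally perturbed planar random walk with unbounded jumps**
(Paulin–Szász).  The Markov chain `S` starts at the origin; from the origin it
jumps to each of the four nearest neighbours with probability `1/4`, and from
every non-origin site it jumps by `± m eᵢ` with probability `c/m³`
(`c = 1/(4ζ(3))`) for every `m ≥ 1` and `i = 1,2`.  Then `S n / √(n log n)`
converges in distribution to a centered planar Gaussian law with covariance
matrix `C² I₂` for some constant `C > 0`. -/
theorem locally_perturbed_unbounded_rw_clt
    {Ω : Type*} [MeasurableSpace Ω] (P : Measure Ω) [IsProbabilityMeasure P]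
    (S : ℕ → Ω → ℤ × ℤ)
    (hmeas : ∀ n, Measurable (S n))
    (hS0 : ∀ᵐ ω ∂P, S 0 ω = (0, 0))
    (hOrigin : ∀ (n : ℕ) (h : ℕ → ℤ × ℤ), h n = (0, 0) → ∀ v ∈ nbrs,
      P ({ω | S (n + 1) ω = h n + v} ∩ prefixEvent S n h)
        = (1/4) * P (prefixEvent S n h))
    (hMarkov : ∀ (n : ℕ) (h : ℕ → ℤ × ℤ), h n ≠ (0, 0) → ∀ m : ℕ, 1 ≤ m →
      ∀ v ∈ nbrs,
      P ({ω | S (n + 1) ω = h n + m • v} ∩ prefixEvent S n h)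
        = ENNReal.ofReal (cZeta / (m : ℝ) ^ 3) * P (prefixEvent S n h)) :
    ∃ C : ℝ≥0, 0 < C ∧
      ∀ f : BoundedContinuousFunction (ℝ × ℝ) ℝ,
        Tendsto
          (fun n : ℕ => ∫ ω, f ((Real.sqrt (n * Real.log n))⁻¹ • embed (S n ω)) ∂P)
          atTop (𝓝 (∫ x, f x ∂(gauss2 (C ^ 2)))) := by
  refine ⟨NNReal.sqrt cZeta.toNNReal, NNReal.sqrt_pos.2 (Real.toNNReal_pos.2 cZeta_pos),
    fun f => ?_⟩
  rw [NNReal.sq_sqrt]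
  have hE : Measurable embed := measurable_of_countable _
  refine tendsto_integral_gauss2 (X := fun n ω => (Real.sqrt (n * Real.log n))⁻¹ • embed (S n ω))
    (fun n => (hE.comp (hmeas n)).fun_const_smul _) _ (fun s => ?_) f
  have h := tendsto_integral_latticeChar hmeas hS0
    (integral_latticeChar_succ hmeas hOrigin hMarkov) s
  rw [Real.coe_toNNReal _ cZeta_pos.le]
  refine h.congr fun n => integral_congr_ae (Eventually.of_forall fun ω => ?_)
  simp only [latticeChar, embed, Prod.smul_mk, Prod.smul_fst, Prod.smul_snd, smul_eq_mul]
  congr 3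
  ring
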